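/- arXiv:2405.15074 — 2 statements merged into one kernel-verified Lean document; each statement's English description precedes it below -/
import Mathlib

section
/- Let X be a real random variable on a probability space with 0 ≤ X ≤ M almost surely for some M > 0 and ℙ(X > 0) > 0, and let ρ > 0. Then for every z ∈ ℂ with Im z > 0 there exists a unique m ∈ ℂ with Im m < 0 satisfying m = 1/(1 + ρ·𝔼[X/(Xm − z)]). Moreover, there is a holomorphic function m : {z ∈ ℂ : Im z > 0} → ℂ whose value at each z is this unique solution. -/
open MeasureTheory

namespace SelfConsistent

open Filter Topology

variable {Ω : Type*} [MeasurableSpace Ω]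

/-- The expectation `𝔼[X / (X m - z)]`. -/
noncomputable def resolventMean (μ : Measure Ω) (X : Ω → ℝ) (m z : ℂ) : ℂ :=
  ∫ ω, (X ω : ℂ) / ((X ω : ℂ) * m - z) ∂μ

/-- The mixed moment `𝔼[X ^ k / ((X m - z) (X m' - z'))]`. -/
noncomputable def mixedMoment (μ : Measure Ω) (X : Ω → ℝ) (k : ℕ) (m z m' z' : ℂ) : ℂ :=
  ∫ ω, (X ω : ℂ) ^ k / (((X ω : ℂ) * m - z) * ((X ω : ℂ) * m' - z')) ∂μ

/-- The moment `𝔼[X ^ k / |X m - z| ^ 2]`. -/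
noncomputable def absMoment (μ : Measure Ω) (X : Ω → ℝ) (k : ℕ) (m z : ℂ) : ℝ :=
  ∫ ω, X ω ^ k / ‖(X ω : ℂ) * m - z‖ ^ 2 ∂μ

lemma im_le_norm_mul_sub {x : ℝ} {m z : ℂ} (hx : 0 ≤ x) (hm : m.im ≤ 0) :
    z.im ≤ ‖(x : ℂ) * m - z‖ := by
  have h := Complex.abs_im_le_norm ((x : ℂ) * m - z)
  have h' : ((x : ℂ) * m - z).im = x * m.im - z.im := by simp
  rw [h'] at h
  have := neg_abs_le (x * m.im - z.im)
  nlinarith [mul_nonneg hx (neg_nonneg.2 hm)]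

lemma mul_sub_ne_zero {x : ℝ} {m z : ℂ} (hx : 0 ≤ x) (hm : m.im ≤ 0) (hz : 0 < z.im) :
    (x : ℂ) * m - z ≠ 0 :=
  norm_pos_iff.1 (hz.trans_le (im_le_norm_mul_sub hx hm))

lemma norm_pow_div_le {x M : ℝ} (hx : x ∈ Set.Icc 0 M) (k : ℕ) {m z m' z' : ℂ}
    (hm : m.im ≤ 0) (hz : 0 < z.im) (hm' : m'.im ≤ 0) (hz' : 0 < z'.im) :
    ‖(x : ℂ) ^ k / (((x : ℂ) * m - z) * ((x : ℂ) * m' - z'))‖ ≤ M ^ k / (z.im * z'.im) := by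
  have h0 := hx.1
  have h1 := im_le_norm_mul_sub (z := z) hx.1 hm
  have h2 := im_le_norm_mul_sub (z := z') hx.1 hm'
  rw [norm_div, norm_mul, norm_pow, Complex.norm_real, Real.norm_of_nonneg hx.1]
  gcongr
  · exact pow_nonneg (h0.trans hx.2) k
  · exact hx.2

lemma absMoment_two_nonneg (μ : Measure Ω) (X : Ω → ℝ) (m z : ℂ) : 0 ≤ absMoment μ X 2 m z :=
  integral_nonneg fun ω => by positivity

variable {μ : Measure Ω} [IsProbabilityMeasure μ] {X : Ω → ℝ} {M : ℝ}

lemma integrable_mixed (hX : Measurable X) (hb : ∀ᵐ ω ∂μ, X ω ∈ Set.Icc 0 M) (k : ℕ)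
    {m z m' z' : ℂ} (hm : m.im ≤ 0) (hz : 0 < z.im) (hm' : m'.im ≤ 0) (hz' : 0 < z'.im) :
    Integrable (fun ω => (X ω : ℂ) ^ k / (((X ω : ℂ) * m - z) * ((X ω : ℂ) * m' - z'))) μ := by
  refine Integrable.of_bound (Measurable.aestronglyMeasurable (by fun_prop)) (M ^ k / (z.im * z'.im)) ?_
  filter_upwards [hb] with ω h using norm_pow_div_le h k hm hz hm' hz'

lemma norm_mixedMoment_le (hb : ∀ᵐ ω ∂μ, X ω ∈ Set.Icc 0 M) (k : ℕ)
    {m z m' z' : ℂ} (hm : m.im ≤ 0) (hz : 0 < z.im) (hm' : m'.im ≤ 0) (hz' : 0 < z'.im) :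
    ‖mixedMoment μ X k m z m' z'‖ ≤ M ^ k / (z.im * z'.im) := by
  have := norm_integral_le_of_norm_le_const (μ := μ)
    (hb.mono fun ω h => norm_pow_div_le h k hm hz hm' hz')
  simpa [mixedMoment] using this

lemma integrable_abs (hX : Measurable X) (hb : ∀ᵐ ω ∂μ, X ω ∈ Set.Icc 0 M) (k : ℕ)
    {m z : ℂ} (hm : m.im ≤ 0) (hz : 0 < z.im) :
    Integrable (fun ω => X ω ^ k / ‖(X ω : ℂ) * m - z‖ ^ 2) μ := by
  refine (integrable_mixed hX hb k hm hz hm hz).norm.congr ?_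
  filter_upwards [hb] with ω h
  rw [norm_div, norm_mul, norm_pow, Complex.norm_real, Real.norm_of_nonneg h.1, sq]

lemma integrable_resolvent (hX : Measurable X) (hb : ∀ᵐ ω ∂μ, X ω ∈ Set.Icc 0 M)
    {m z : ℂ} (hm : m.im ≤ 0) (hz : 0 < z.im) :
    Integrable (fun ω => (X ω : ℂ) / ((X ω : ℂ) * m - z)) μ := by
  refine Integrable.of_bound (Measurable.aestronglyMeasurable (by fun_prop)) (M / z.im) ?_
  filter_upwards [hb] with ω h
  have h0 := h.1
  have h1 := im_le_norm_mul_sub (z := z) h.1 hm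
  rw [norm_div, Complex.norm_real, Real.norm_of_nonneg h.1]
  gcongr
  · exact h0.trans h.2
  · exact h.2

lemma resolventMean_im (hX : Measurable X) (hb : ∀ᵐ ω ∂μ, X ω ∈ Set.Icc 0 M)
    {m z : ℂ} (hm : m.im ≤ 0) (hz : 0 < z.im) :
    (resolventMean μ X m z).im = z.im * absMoment μ X 1 m z - m.im * absMoment μ X 2 m z := by
  have h := integral_im (𝕜 := ℂ) (integrable_resolvent hX hb hm hz)
  simp only [RCLike.im_to_complex] at h
  rw [resolventMean, ← h, absMoment, absMoment, ← integral_const_mul, ← integral_const_mul,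
    ← integral_sub ((integrable_abs hX hb 1 hm hz).const_mul _)
      ((integrable_abs hX hb 2 hm hz).const_mul _)]
  congr 1 with ω
  rw [Complex.sq_norm, Complex.div_im]
  simp
  ring

lemma absMoment_two_le (hX : Measurable X) (hb : ∀ᵐ ω ∂μ, X ω ∈ Set.Icc 0 M)
    {m z : ℂ} (hm : m.im ≤ 0) (hz : 0 < z.im) :
    absMoment μ X 2 m z ≤ M * absMoment μ X 1 m z := by
  rw [absMoment, absMoment, ← integral_const_mul]
  refine integral_mono_ae (integrable_abs hX hb 2 hm hz)
    ((integrable_abs hX hb 1 hm hz).const_mul _) ?_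
  filter_upwards [hb] with ω h
  rw [pow_one, ← mul_div_assoc]
  gcongr
  nlinarith [h.1, h.2]

lemma integral_pos_of_bdd (hX : Measurable X) (hb : ∀ᵐ ω ∂μ, X ω ∈ Set.Icc 0 M)
    (hpos : 0 < μ {ω | 0 < X ω}) : 0 < ∫ ω, X ω ∂μ := by
  have hint : Integrable X μ := Integrable.of_mem_Icc 0 M hX.aemeasurable hb
  rw [integral_pos_iff_support_of_nonneg_ae (hb.mono fun ω h => h.1) hint]
  exact hpos.trans_le (measure_mono fun ω h => ne_of_gt h)

lemma integral_div_le_absMoment_one (hX : Measurable X) (hb : ∀ᵐ ω ∂μ, X ω ∈ Set.Icc 0 M)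
    {m z : ℂ} (hm : m.im ≤ 0) (hz : 0 < z.im) {K : ℝ} (hK : ‖m‖ ≤ K) :
    (∫ ω, X ω ∂μ) / (M * K + ‖z‖) ^ 2 ≤ absMoment μ X 1 m z := by
  have hint : Integrable X μ := Integrable.of_mem_Icc 0 M hX.aemeasurable hb
  rw [absMoment, ← integral_div]
  refine integral_mono_ae (hint.div_const _) (integrable_abs hX hb 1 hm hz) ?_
  filter_upwards [hb] with ω h
  have h0 := h.1
  have h1 : 0 < ‖(X ω : ℂ) * m - z‖ := norm_pos_iff.2 (mul_sub_ne_zero h.1 hm hz)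
  have h2 : ‖(X ω : ℂ) * m - z‖ ≤ M * K + ‖z‖ := by
    refine (norm_sub_le _ _).trans ?_
    rw [norm_mul, Complex.norm_real, Real.norm_of_nonneg h.1]
    gcongr
    · exact h.1.trans h.2
    · exact h.2
  simp only [pow_one]
  gcongr

lemma absMoment_one_pos (hX : Measurable X) (hb : ∀ᵐ ω ∂μ, X ω ∈ Set.Icc 0 M)
    (hM : 0 < M) (hpos : 0 < μ {ω | 0 < X ω}) {m z : ℂ} (hm : m.im ≤ 0) (hz : 0 < z.im) :
    0 < absMoment μ X 1 m z := by
  refine lt_of_lt_of_le ?_ (integral_div_le_absMoment_one hX hb hm hz le_rfl)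
  have := integral_pos_of_bdd hX hb hpos
  have hz0 : 0 < ‖z‖ := norm_pos_iff.2 fun h => by simp [h] at hz
  positivity

lemma resolventMean_sub (hX : Measurable X) (hb : ∀ᵐ ω ∂μ, X ω ∈ Set.Icc 0 M)
    {m z m' z' : ℂ} (hm : m.im ≤ 0) (hz : 0 < z.im) (hm' : m'.im ≤ 0) (hz' : 0 < z'.im) :
    resolventMean μ X m z - resolventMean μ X m' z' =
      (z - z') * mixedMoment μ X 1 m z m' z' - (m - m') * mixedMoment μ X 2 m z m' z' := by
  rw [resolventMean, resolventMean, mixedMoment, mixedMoment, ← integral_const_mul,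
    ← integral_const_mul,
    ← integral_sub (integrable_resolvent hX hb hm hz) (integrable_resolvent hX hb hm' hz'),
    ← integral_sub ((integrable_mixed hX hb 1 hm hz hm' hz').const_mul _)
      ((integrable_mixed hX hb 2 hm hz hm' hz').const_mul _)]
  refine integral_congr_ae ?_
  filter_upwards [hb] with ω h
  have h1 := mul_sub_ne_zero h.1 hm hz
  have h2 := mul_sub_ne_zero h.1 hm' hz'
  field_simp
  ring

lemma norm_mixedMoment_two_sq_le (hX : Measurable X) (hb : ∀ᵐ ω ∂μ, X ω ∈ Set.Icc 0 M)
    {m z m' z' : ℂ} (hm : m.im ≤ 0) (hz : 0 < z.im) (hm' : m'.im ≤ 0) (hz' : 0 < z'.im) :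
    ‖mixedMoment μ X 2 m z m' z'‖ ^ 2 ≤ absMoment μ X 2 m z * absMoment μ X 2 m' z' := by
  set I : ℝ := ∫ ω, ‖(X ω : ℂ) ^ 2 / (((X ω : ℂ) * m - z) * ((X ω : ℂ) * m' - z'))‖ ∂μ with hI
  have hle : ‖mixedMoment μ X 2 m z m' z'‖ ≤ I := norm_integral_le_integral_norm _
  have hquad : ∀ t : ℝ, 0 ≤ absMoment μ X 2 m z * (t * t) + (-2 * I) * t
      + absMoment μ X 2 m' z' := by
    intro t
    have i1 := (integrable_abs hX hb 2 hm hz).mul_const (t * t)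
    have i2 := ((integrable_mixed hX hb 2 hm hz hm' hz').norm.const_mul (-2)).mul_const t
    have i3 := integrable_abs hX hb 2 hm' hz'
    have i12 := i1.add i2
    rw [absMoment, absMoment, hI, ← integral_mul_const, ← integral_const_mul,
      ← integral_mul_const, ← integral_add i1 i2]
    refine le_of_le_of_eq ?_ (integral_add i12 i3)
    refine integral_nonneg fun ω => ?_
    have : 0 ≤ (|X ω| / ‖(X ω : ℂ) * m - z‖ * t - |X ω| / ‖(X ω : ℂ) * m' - z'‖) ^ 2 :=
      sq_nonneg _
    refine this.trans_eq ?_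
    simp only [norm_div, norm_mul, norm_pow, Complex.norm_real, Real.norm_eq_abs,
      ← sq_abs (X ω)]
    ring
  have := discrim_le_zero hquad
  rw [discrim] at this
  have : I ^ 2 ≤ absMoment μ X 2 m z * absMoment μ X 2 m' z' := by nlinarith
  exact (pow_le_pow_left₀ (norm_nonneg _) hle 2).trans this

/-- The right-hand side of the self-consistent equation, as a function of `m` and `z`. -/
noncomputable def selfMap (μ : Measure Ω) (X : Ω → ℝ) (ρ : ℝ) (z m : ℂ) : ℂ :=
  1 / (1 + (ρ : ℂ) * resolventMean μ X m z)

variable {ρ : ℝ}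

lemma denom_im_pos (hX : Measurable X) (hb : ∀ᵐ ω ∂μ, X ω ∈ Set.Icc 0 M) (hM : 0 < M)
    (hpos : 0 < μ {ω | 0 < X ω}) (hρ : 0 < ρ) {m z : ℂ} (hm : m.im ≤ 0) (hz : 0 < z.im) :
    0 < (1 + (ρ : ℂ) * resolventMean μ X m z).im := by
  have h1 := absMoment_one_pos hX hb hM hpos hm hz
  have h2 := absMoment_two_nonneg μ X m z
  simp only [Complex.add_im, Complex.one_im, Complex.im_ofReal_mul,
    resolventMean_im hX hb hm hz, zero_add]
  have : 0 ≤ -m.im * absMoment μ X 2 m z := mul_nonneg (by linarith) h2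
  have : 0 < z.im * absMoment μ X 1 m z := by positivity
  apply mul_pos hρ
  linarith

lemma denom_ne_zero (hX : Measurable X) (hb : ∀ᵐ ω ∂μ, X ω ∈ Set.Icc 0 M) (hM : 0 < M)
    (hpos : 0 < μ {ω | 0 < X ω}) (hρ : 0 < ρ) {m z : ℂ} (hm : m.im ≤ 0) (hz : 0 < z.im) :
    1 + (ρ : ℂ) * resolventMean μ X m z ≠ 0 := fun h => by
  have := denom_im_pos hX hb hM hpos hρ hm hz
  simp [h] at this

lemma neg_selfMap_im (hX : Measurable X) (hb : ∀ᵐ ω ∂μ, X ω ∈ Set.Icc 0 M)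
    {m z : ℂ} (hm : m.im ≤ 0) (hz : 0 < z.im) :
    -(selfMap μ X ρ z m).im = ρ * ‖selfMap μ X ρ z m‖ ^ 2 *
      (z.im * absMoment μ X 1 m z + -m.im * absMoment μ X 2 m z) := by
  have h : (1 + (ρ : ℂ) * resolventMean μ X m z).im =
      ρ * (z.im * absMoment μ X 1 m z + -m.im * absMoment μ X 2 m z) := by
    simp only [Complex.add_im, Complex.one_im, Complex.im_ofReal_mul,
      resolventMean_im hX hb hm hz, zero_add]
    ring
  rw [selfMap, one_div, Complex.inv_im, norm_inv, inv_pow, Complex.sq_norm, h]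
  ring

lemma selfMap_im_neg (hX : Measurable X) (hb : ∀ᵐ ω ∂μ, X ω ∈ Set.Icc 0 M) (hM : 0 < M)
    (hpos : 0 < μ {ω | 0 < X ω}) (hρ : 0 < ρ) {m z : ℂ} (hm : m.im ≤ 0) (hz : 0 < z.im) :
    (selfMap μ X ρ z m).im < 0 := by
  have h := denom_im_pos hX hb hM hpos hρ hm hz
  have h0 := Complex.normSq_pos.2 (denom_ne_zero hX hb hM hpos hρ hm hz)
  rw [selfMap, one_div, Complex.inv_im]
  exact div_neg_of_neg_of_pos (neg_lt_zero.2 h) h0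

/-- The contraction factor of `selfMap` on the strip `-R ≤ Im m ≤ 0`. -/
noncomputable def contractionFactor (M R : ℝ) (z : ℂ) : ℝ := M * R / (M * R + z.im)

lemma contractionFactor_nonneg {R : ℝ} {z : ℂ} (hM : 0 < M) (hR : 0 < R) (hz : 0 < z.im) :
    0 ≤ contractionFactor M R z := by
  unfold contractionFactor; positivity

lemma contractionFactor_lt_one {R : ℝ} {z : ℂ} (hM : 0 < M) (hR : 0 < R) (hz : 0 < z.im) :
    contractionFactor M R z < 1 := by
  unfold contractionFactor
  rw [div_lt_one (by positivity)]
  linarith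

lemma weighted_absMoment_le (hX : Measurable X) (hb : ∀ᵐ ω ∂μ, X ω ∈ Set.Icc 0 M) (hM : 0 < M)
    (hρ : 0 < ρ) {m z : ℂ} (hm : m.im ≤ 0) (hz : 0 < z.im) {R : ℝ} (hR : 0 < R)
    (hmR : -m.im ≤ R) :
    ρ * ‖selfMap μ X ρ z m‖ ^ 2 * absMoment μ X 2 m z * -m.im ≤
      contractionFactor M R z * -(selfMap μ X ρ z m).im := by
  have h1 := absMoment_two_le hX hb hm hz
  have h2 := absMoment_two_nonneg μ X m z
  rw [neg_selfMap_im hX hb hm hz, contractionFactor, div_mul_eq_mul_div,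
    le_div_iff₀ (by positivity)]
  have h3 : -m.im * absMoment μ X 2 m z ≤ R * (M * absMoment μ X 1 m z) := by gcongr
  have h4 : 0 ≤ ρ * ‖selfMap μ X ρ z m‖ ^ 2 := by positivity
  have h5 := mul_le_mul_of_nonneg_left h3 (mul_nonneg h4 hz.le)
  linarith

lemma selfMap_sub (hX : Measurable X) (hb : ∀ᵐ ω ∂μ, X ω ∈ Set.Icc 0 M) (hM : 0 < M)
    (hpos : 0 < μ {ω | 0 < X ω}) (hρ : 0 < ρ) {m z m' z' : ℂ} (hm : m.im ≤ 0) (hz : 0 < z.im)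
    (hm' : m'.im ≤ 0) (hz' : 0 < z'.im) :
    selfMap μ X ρ z m - selfMap μ X ρ z' m' =
      ρ * selfMap μ X ρ z m * selfMap μ X ρ z' m' *
        ((m - m') * mixedMoment μ X 2 m z m' z' - (z - z') * mixedMoment μ X 1 m z m' z') := by
  have h := resolventMean_sub hX hb hm hz hm' hz'
  have h1 := denom_ne_zero hX hb hM hpos hρ hm hz
  have h2 := denom_ne_zero hX hb hM hpos hρ hm' hz'
  rw [← neg_sub ((z - z') * _), ← h, selfMap, selfMap]
  field_simp
  ring

lemma norm_mul_mixedMoment_sq_le (hX : Measurable X) (hb : ∀ᵐ ω ∂μ, X ω ∈ Set.Icc 0 M)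
    {m z m' z' : ℂ} (hm : m.im ≤ 0) (hz : 0 < z.im) (hm' : m'.im ≤ 0) (hz' : 0 < z'.im)
    (a a' : ℂ) :
    ‖(ρ : ℂ) * a * a' * mixedMoment μ X 2 m z m' z'‖ ^ 2 ≤
      (ρ * ‖a‖ ^ 2 * absMoment μ X 2 m z) * (ρ * ‖a'‖ ^ 2 * absMoment μ X 2 m' z') := by
  have h := norm_mixedMoment_two_sq_le hX hb hm hz hm' hz'
  rw [norm_mul, norm_mul, norm_mul, Complex.norm_real, mul_pow, mul_pow, mul_pow,
    Real.norm_eq_abs, sq_abs]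
  calc _ ≤ ρ ^ 2 * ‖a‖ ^ 2 * ‖a'‖ ^ 2 * (absMoment μ X 2 m z * absMoment μ X 2 m' z') := by
        gcongr
    _ = _ := by ring

lemma selfMap_contraction (hX : Measurable X) (hb : ∀ᵐ ω ∂μ, X ω ∈ Set.Icc 0 M) (hM : 0 < M)
    (hpos : 0 < μ {ω | 0 < X ω}) (hρ : 0 < ρ) {m m' z : ℂ} (hm : m.im ≤ 0)
    (hm' : m'.im ≤ 0) (hz : 0 < z.im) {R : ℝ} (hR : 0 < R) (hmR : -m.im ≤ R)
    (hmR' : -m'.im ≤ R) :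
    ‖selfMap μ X ρ z m - selfMap μ X ρ z m'‖ ^ 2 * (-m.im * -m'.im) ≤
      contractionFactor M R z ^ 2 * ‖m - m'‖ ^ 2 *
        (-(selfMap μ X ρ z m).im * -(selfMap μ X ρ z m').im) := by
  have h := selfMap_sub hX hb hM hpos hρ hm hz hm' hz
  have hθ := contractionFactor_nonneg hM hR hz
  have hF := selfMap_im_neg hX hb hM hpos hρ hm hz
  rw [sub_self, zero_mul, sub_zero, mul_left_comm] at h
  rw [h, norm_mul, mul_pow]
  have h1 := norm_mul_mixedMoment_sq_le (ρ := ρ) hX hb hm hz hm' hz (selfMap μ X ρ z m)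
    (selfMap μ X ρ z m')
  have h2 := weighted_absMoment_le hX hb hM hρ hm hz hR hmR
  have h3 := weighted_absMoment_le hX hb hM hρ hm' hz hR hmR'
  have n1 := absMoment_two_nonneg μ X m z
  have n2 := absMoment_two_nonneg μ X m' z
  have p1 : 0 ≤ -m.im := by linarith
  have p2 : 0 ≤ -m'.im := by linarith
  have h4 := mul_le_mul h2 h3 (mul_nonneg (by positivity) p2)
    (mul_nonneg hθ (by linarith))
  have h5 := mul_le_mul_of_nonneg_left (mul_le_mul_of_nonneg_right h1 (mul_nonneg p1 p2))
    (sq_nonneg ‖m - m'‖)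
  have h6 := mul_le_mul_of_nonneg_left h4 (sq_nonneg ‖m - m'‖)
  linarith

lemma fixedPoint_unique (hX : Measurable X) (hb : ∀ᵐ ω ∂μ, X ω ∈ Set.Icc 0 M) (hM : 0 < M)
    (hpos : 0 < μ {ω | 0 < X ω}) (hρ : 0 < ρ) {m m' z : ℂ} (hm : m.im < 0)
    (hm' : m'.im < 0) (hz : 0 < z.im) (h : m = selfMap μ X ρ z m)
    (h' : m' = selfMap μ X ρ z m') : m = m' := by
  have hR : 0 < max (-m.im) (-m'.im) := lt_max_of_lt_left (by linarith)
  have hc := selfMap_contraction hX hb hM hpos hρ hm.le hm'.le hz hR (le_max_left _ _)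
    (le_max_right _ _)
  rw [← h, ← h'] at hc
  have h0 := contractionFactor_nonneg hM hR hz
  have h1 := contractionFactor_lt_one hM hR hz
  have hp : 0 < -m.im * -m'.im := mul_pos (by linarith) (by linarith)
  have hc' := le_of_mul_le_mul_right hc hp
  have h2 : contractionFactor M (max (-m.im) (-m'.im)) z ^ 2 < 1 := by nlinarith
  have h3 : ‖m - m'‖ ^ 2 = 0 := by nlinarith [sq_nonneg ‖m - m'‖]
  exact sub_eq_zero.1 (norm_eq_zero.1 (pow_eq_zero_iff two_ne_zero |>.1 h3))

lemma norm_mul_resolventMean_le (hb : ∀ᵐ ω ∂μ, X ω ∈ Set.Icc 0 M)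
    {m z : ℂ} (hm : m.im ≤ 0) (hz : 0 < z.im) :
    ‖m‖ * ‖resolventMean μ X m z‖ ≤ 1 + ‖z‖ / z.im := by
  rw [← norm_mul, resolventMean, ← integral_const_mul]
  have := norm_integral_le_of_norm_le_const (μ := μ) (C := 1 + ‖z‖ / z.im)
    (f := fun ω => m * ((X ω : ℂ) / ((X ω : ℂ) * m - z))) ?_
  · simpa using this
  filter_upwards [hb] with ω h
  have h1 := mul_sub_ne_zero h.1 hm hz
  have h2 : m * ((X ω : ℂ) / ((X ω : ℂ) * m - z)) = 1 + z / ((X ω : ℂ) * m - z) := by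
    rw [← mul_div_assoc, one_add_div h1]
    congr 1
    ring
  rw [h2]
  refine (norm_add_le _ _).trans ?_
  rw [norm_one, norm_div]
  gcongr
  exact im_le_norm_mul_sub h.1 hm

lemma exists_norm_selfMap_le (hX : Measurable X) (hb : ∀ᵐ ω ∂μ, X ω ∈ Set.Icc 0 M) (hM : 0 < M)
    (hpos : 0 < μ {ω | 0 < X ω}) (hρ : 0 < ρ) {z : ℂ} (hz : 0 < z.im) :
    ∃ R : ℝ, ∀ m : ℂ, m.im ≤ 0 → ‖selfMap μ X ρ z m‖ ≤ R := by
  set C : ℝ := 1 + ‖z‖ / z.im with hC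
  have hC0 : 0 < C := by positivity
  set K : ℝ := 2 * ρ * C with hK
  set c : ℝ := ρ * (z.im * ((∫ ω, X ω ∂μ) / (M * K + ‖z‖) ^ 2)) with hc
  have hc0 : 0 < c := by
    have := integral_pos_of_bdd hX hb hpos
    positivity
  refine ⟨max 2 c⁻¹, fun m hm => ?_⟩
  rw [selfMap, one_div, norm_inv]
  rcases le_total ‖m‖ K with h | h
  · refine le_max_of_le_right (inv_anti₀ hc0 ?_)
    refine le_trans ?_ ((le_abs_self _).trans (Complex.abs_im_le_norm _))
    simp only [Complex.add_im, Complex.one_im, Complex.im_ofReal_mul,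
      resolventMean_im hX hb hm hz, zero_add]
    have h1 := integral_div_le_absMoment_one hX hb hm hz h
    have h2 : 0 ≤ -m.im * absMoment μ X 2 m z :=
      mul_nonneg (by linarith) (absMoment_two_nonneg μ X m z)
    rw [hc]
    gcongr
    have := mul_le_mul_of_nonneg_left h1 hz.le
    linarith
  · refine le_max_of_le_left ?_
    rw [inv_le_comm₀ (norm_pos_iff.2 (denom_ne_zero hX hb hM hpos hρ hm hz)) two_pos]
    have h1 := norm_mul_resolventMean_le hb hm hz
    have h2 : ρ * ‖resolventMean μ X m z‖ ≤ 1 / 2 := by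
      have h3 : K * ‖resolventMean μ X m z‖ ≤ C :=
        (mul_le_mul_of_nonneg_right h (norm_nonneg _)).trans h1
      have h4 : C * (ρ * ‖resolventMean μ X m z‖) ≤ C * (1 / 2) := by
        rw [hK] at h3
        linarith
      exact le_of_mul_le_mul_left h4 hC0
    have h5 := norm_sub_le (1 + (ρ : ℂ) * resolventMean μ X m z)
      ((ρ : ℂ) * resolventMean μ X m z)
    rw [add_sub_cancel_right, norm_one, norm_mul (ρ : ℂ), Complex.norm_real,
      Real.norm_of_nonneg hρ.le] at h5
    linarith

lemma exists_fixedPoint (hX : Measurable X) (hb : ∀ᵐ ω ∂μ, X ω ∈ Set.Icc 0 M) (hM : 0 < M)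
    (hpos : 0 < μ {ω | 0 < X ω}) (hρ : 0 < ρ) {z : ℂ} (hz : 0 < z.im) :
    ∃ m : ℂ, m.im < 0 ∧ m = selfMap μ X ρ z m := by
  obtain ⟨R₀, hR₀⟩ := exists_norm_selfMap_le hX hb hM hpos hρ hz
  set R : ℝ := max 1 R₀ with hRdef
  have hR : 0 < R := lt_max_of_lt_left one_pos
  set θ := contractionFactor M R z
  have hθ0 : 0 ≤ θ := contractionFactor_nonneg hM hR hz
  have hθ1 : θ < 1 := contractionFactor_lt_one hM hR hz
  set u : ℕ → ℂ := fun n => (selfMap μ X ρ z)^[n] (-Complex.I) with hu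
  have hus : ∀ n, u (n + 1) = selfMap μ X ρ z (u n) := fun n =>
    Function.iterate_succ_apply' _ _ _
  have him : ∀ n, (u n).im < 0 := by
    intro n
    induction n with
    | zero => simp [hu]
    | succ n ih => rw [hus]; exact selfMap_im_neg hX hb hM hpos hρ ih.le hz
  have hle : ∀ n, -(u n).im ≤ R := by
    intro n
    cases n with
    | zero => simp [hu, hRdef]
    | succ n =>
      rw [hus]
      exact (neg_le_abs _).trans ((Complex.abs_im_le_norm _).trans
        ((hR₀ _ (him n).le).trans (le_max_right _ _)))
  set e : ℝ := ‖u 0 - u 1‖ ^ 2 / (-(u 0).im * -(u 1).im) with he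
  have hprod : ∀ n, 0 < -(u n).im * -(u (n + 1)).im := fun n =>
    mul_pos (neg_pos.2 (him n)) (neg_pos.2 (him _))
  have hgeom : ∀ n, ‖u n - u (n + 1)‖ ^ 2 ≤
      (θ ^ n) ^ 2 * e * (-(u n).im * -(u (n + 1)).im) := by
    intro n
    induction n with
    | zero => simp only [pow_zero, one_pow, one_mul, he]; rw [div_mul_cancel₀ _ (hprod 0).ne']
    | succ n ih =>
      have h := selfMap_contraction hX hb hM hpos hρ (him n).le (him (n + 1)).le hz hR
        (hle _) (hle _)
      rw [← hus, ← hus] at h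
      have h' := mul_le_mul_of_nonneg_right (mul_le_mul_of_nonneg_left ih (sq_nonneg θ))
        (hprod (n + 1)).le
      refine le_of_mul_le_mul_right ((h.trans h').trans_eq ?_) (hprod n)
      ring
  have he0 : 0 ≤ e := div_nonneg (sq_nonneg _) (hprod 0).le
  have hdist : ∀ n, dist (u n) (u (n + 1)) ≤ (R * √e) * θ ^ n := by
    intro n
    rw [dist_eq_norm]
    refine le_of_sq_le_sq ?_ (by positivity)
    refine (hgeom n).trans ?_
    have h2 : -(u n).im * -(u (n + 1)).im ≤ R * R :=
      mul_le_mul (hle _) (hle _) (neg_nonneg.2 (him _).le) hR.le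
    calc _ ≤ (θ ^ n) ^ 2 * e * (R * R) := by gcongr
      _ = (R * √e * θ ^ n) ^ 2 := by
        rw [mul_pow, mul_pow, Real.sq_sqrt he0]
        ring
  obtain ⟨m, hm⟩ := cauchySeq_tendsto_of_complete (cauchySeq_of_le_geometric θ _ hθ1 hdist)
  have hm0 : m.im ≤ 0 :=
    le_of_tendsto ((Complex.continuous_im.tendsto m).comp hm) (Eventually.of_forall
      fun n => (him n).le)
  have hG : Tendsto (fun n => resolventMean μ X (u n) z) atTop (𝓝 (resolventMean μ X m z)) := by
    rw [tendsto_iff_norm_sub_tendsto_zero]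
    have h0 : Tendsto (fun n => ‖u n - m‖ * (M ^ 2 / (z.im * z.im))) atTop (𝓝 0) := by
      simpa using (tendsto_iff_norm_sub_tendsto_zero.1 hm).mul_const (M ^ 2 / (z.im * z.im))
    refine squeeze_zero (fun _ => norm_nonneg _) (fun n => ?_) h0
    rw [resolventMean_sub hX hb (him n).le hz hm0 hz, sub_self, zero_mul, zero_sub, norm_neg,
      norm_mul]
    gcongr
    exact norm_mixedMoment_le hb 2 (him n).le hz hm0 hz
  have hfix : m = selfMap μ X ρ z m := by
    have h1 : Tendsto (fun n => u (n + 1)) atTop (𝓝 (selfMap μ X ρ z m)) := by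
      simp only [hus]
      exact tendsto_const_nhds.div (tendsto_const_nhds.add (hG.const_mul _))
        (denom_ne_zero hX hb hM hpos hρ hm0 hz)
    exact tendsto_nhds_unique ((tendsto_add_atTop_iff_nat 1).2 hm) h1
  exact ⟨m, hfix ▸ selfMap_im_neg hX hb hM hpos hρ hm0 hz, hfix⟩

lemma fixedPoint_absMoment_lt_one (hX : Measurable X) (hb : ∀ᵐ ω ∂μ, X ω ∈ Set.Icc 0 M)
    (hM : 0 < M) (hρ : 0 < ρ) {m z : ℂ} (hm : m.im < 0) (hz : 0 < z.im)
    (h : m = selfMap μ X ρ z m) : ρ * ‖m‖ ^ 2 * absMoment μ X 2 m z < 1 := by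
  have hv : 0 < -m.im := neg_pos.2 hm
  have h1 := weighted_absMoment_le hX hb hM hρ hm.le hz hv le_rfl
  rw [← h] at h1
  exact (le_of_mul_le_mul_right h1 hv).trans_lt (contractionFactor_lt_one hM hv hz)

lemma fixedPoint_sub (hX : Measurable X) (hb : ∀ᵐ ω ∂μ, X ω ∈ Set.Icc 0 M) (hM : 0 < M)
    (hpos : 0 < μ {ω | 0 < X ω}) (hρ : 0 < ρ) {m z m' z' : ℂ} (hm : m.im < 0) (hz : 0 < z.im)
    (hm' : m'.im < 0) (hz' : 0 < z'.im) (h : m = selfMap μ X ρ z m)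
    (h' : m' = selfMap μ X ρ z' m') :
    (m - m') * (1 - ρ * m * m' * mixedMoment μ X 2 m z m' z') =
      -(ρ * m * m' * mixedMoment μ X 1 m z m' z') * (z - z') := by
  have hs := selfMap_sub hX hb hM hpos hρ hm.le hz hm'.le hz'
  rw [← h, ← h'] at hs
  linear_combination hs

lemma tendsto_mixedMoment (hX : Measurable X) (hb : ∀ᵐ ω ∂μ, X ω ∈ Set.Icc 0 M) (k : ℕ)
    {f : ℂ → ℂ} {z₀ : ℂ} {l : Filter ℂ} [l.IsCountablyGenerated] (hl : l ≤ 𝓝 z₀)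
    (hz₀ : 0 < z₀.im) (hf₀ : (f z₀).im ≤ 0) (hf : ∀ᶠ z in l, (f z).im ≤ 0)
    (hlim : Tendsto f l (𝓝 (f z₀))) :
    Tendsto (fun z => mixedMoment μ X k (f z) z (f z₀) z₀) l
      (𝓝 (mixedMoment μ X k (f z₀) z₀ (f z₀) z₀)) := by
  have him : ∀ᶠ z in l, z₀.im / 2 < z.im :=
    ((Complex.continuous_im.tendsto z₀).mono_left hl).eventually (lt_mem_nhds (half_lt_self hz₀))
  refine tendsto_integral_filter_of_dominated_convergence
    (fun _ => M ^ k / (z₀.im / 2 * z₀.im)) ?_ ?_ (integrable_const _) ?_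
  · exact Eventually.of_forall fun z => Measurable.aestronglyMeasurable (by fun_prop)
  · filter_upwards [hf, him] with z hz hz'
    filter_upwards [hb] with ω h
    have hMk : 0 ≤ M ^ k := pow_nonneg (h.1.trans h.2) k
    have hzp : 0 < z.im := (half_pos hz₀).trans hz'
    refine (norm_pow_div_le h k hz hzp hf₀ hz₀).trans ?_
    gcongr
  · filter_upwards [hb] with ω h
    have h0 := mul_sub_ne_zero h.1 hf₀ hz₀
    have hid : Tendsto (fun z : ℂ => z) l (𝓝 z₀) := hl
    exact tendsto_const_nhds.div (((hlim.const_mul _).sub hid).mul tendsto_const_nhds)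
      (mul_ne_zero h0 h0)

lemma norm_mul_mixedMoment_le_sqrt (hX : Measurable X) (hb : ∀ᵐ ω ∂μ, X ω ∈ Set.Icc 0 M)
    (hM : 0 < M) (hρ : 0 < ρ) {m z m' z' : ℂ} (hm : m.im < 0) (hz : 0 < z.im)
    (hm' : m'.im < 0) (hz' : 0 < z'.im) (h : m = selfMap μ X ρ z m) :
    ‖(ρ : ℂ) * m * m' * mixedMoment μ X 2 m z m' z'‖ ≤
      √(ρ * ‖m'‖ ^ 2 * absMoment μ X 2 m' z') := by
  refine Real.le_sqrt_of_sq_le ?_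
  refine (norm_mul_mixedMoment_sq_le hX hb hm.le hz hm'.le hz' m m').trans ?_
  have h1 := fixedPoint_absMoment_lt_one hX hb hM hρ hm hz h
  have h2 := absMoment_two_nonneg μ X m' z'
  exact mul_le_of_le_one_left (by positivity) h1.le

lemma tendsto_fixedPoint (hX : Measurable X) (hb : ∀ᵐ ω ∂μ, X ω ∈ Set.Icc 0 M) (hM : 0 < M)
    (hpos : 0 < μ {ω | 0 < X ω}) (hρ : 0 < ρ) {f : ℂ → ℂ}
    (hf : ∀ z : ℂ, 0 < z.im → (f z).im < 0 ∧ f z = selfMap μ X ρ z (f z))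
    {z₀ : ℂ} (hz₀ : 0 < z₀.im) : Tendsto f (𝓝 z₀) (𝓝 (f z₀)) := by
  obtain ⟨hm₀, he₀⟩ := hf z₀ hz₀
  set s := √(ρ * ‖f z₀‖ ^ 2 * absMoment μ X 2 (f z₀) z₀) with hs
  have hs1 : s < 1 := by
    rw [hs, Real.sqrt_lt' one_pos, one_pow]
    exact fixedPoint_absMoment_lt_one hX hb hM hρ hm₀ hz₀ he₀
  set c : ℝ := ρ * ‖f z₀‖ * (M ^ 1 / (z₀.im / 2 * z₀.im)) with hc
  have hc0 : 0 ≤ c := by positivity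
  have him : ∀ᶠ z in 𝓝 z₀, z₀.im / 2 < z.im :=
    (Complex.continuous_im.tendsto z₀).eventually (lt_mem_nhds (half_lt_self hz₀))
  have hdist : Tendsto (fun z => ‖z - z₀‖) (𝓝 z₀) (𝓝 0) :=
    tendsto_iff_norm_sub_tendsto_zero.1 tendsto_id
  have hsmall : ∀ᶠ z in 𝓝 z₀, c * ‖z - z₀‖ < (1 - s) / 2 := by
    have h : Tendsto (fun z => c * ‖z - z₀‖) (𝓝 z₀) (𝓝 0) := by simpa using hdist.const_mul c
    exact h.eventually (gt_mem_nhds (by linarith))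
  rw [tendsto_iff_norm_sub_tendsto_zero]
  have hbound : Tendsto (fun z => 2 * c * ‖f z₀‖ / (1 - s) * ‖z - z₀‖) (𝓝 z₀) (𝓝 0) := by
    simpa using hdist.const_mul (2 * c * ‖f z₀‖ / (1 - s))
  refine squeeze_zero' (Eventually.of_forall fun _ => norm_nonneg _) ?_ hbound
  filter_upwards [him, hsmall] with z hz hzs
  have hzp : 0 < z.im := (half_pos hz₀).trans hz
  obtain ⟨hm, he⟩ := hf z hzp
  have heq := congrArg norm (fixedPoint_sub hX hb hM hpos hρ hm hzp hm₀ hz₀ he he₀)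
  rw [norm_mul, norm_mul, norm_neg] at heq
  have hL := norm_mul_mixedMoment_le_sqrt hX hb hM hρ hm hzp hm₀ hz₀ he
  have hL' := norm_sub_norm_le 1 ((ρ : ℂ) * f z * f z₀ * mixedMoment μ X 2 (f z) z (f z₀) z₀)
  rw [norm_one] at hL'
  have hA : ‖(ρ : ℂ) * f z * f z₀ * mixedMoment μ X 1 (f z) z (f z₀) z₀‖ ≤ c * ‖f z‖ := by
    rw [norm_mul, norm_mul, norm_mul, Complex.norm_real, Real.norm_of_nonneg hρ.le]
    calc _ ≤ ρ * ‖f z‖ * ‖f z₀‖ * (M ^ 1 / (z₀.im / 2 * z₀.im)) := by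
          gcongr
          refine (norm_mixedMoment_le hb 1 hm.le hzp hm₀.le hz₀).trans ?_
          gcongr
      _ = c * ‖f z‖ := by rw [hc]; ring
  have h1 : ‖f z - f z₀‖ * (1 - s) ≤ c * ‖f z‖ * ‖z - z₀‖ :=
    (mul_le_mul_of_nonneg_left (by linarith) (norm_nonneg _)).trans
      (heq.le.trans (mul_le_mul_of_nonneg_right hA (norm_nonneg _)))
  have h2 : ‖f z‖ ≤ ‖f z₀‖ + ‖f z - f z₀‖ := by
    simpa using norm_add_le (f z₀) (f z - f z₀)
  have h3 := mul_le_mul_of_nonneg_left h2 (mul_nonneg hc0 (norm_nonneg (z - z₀)))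
  have h4 := mul_le_mul_of_nonneg_right hzs.le (norm_nonneg (f z - f z₀))
  rw [div_mul_eq_mul_div, le_div_iff₀ (by linarith)]
  linarith

lemma differentiableAt_fixedPoint (hX : Measurable X) (hb : ∀ᵐ ω ∂μ, X ω ∈ Set.Icc 0 M)
    (hM : 0 < M) (hpos : 0 < μ {ω | 0 < X ω}) (hρ : 0 < ρ) {f : ℂ → ℂ}
    (hf : ∀ z : ℂ, 0 < z.im → (f z).im < 0 ∧ f z = selfMap μ X ρ z (f z))
    {z₀ : ℂ} (hz₀ : 0 < z₀.im) : DifferentiableAt ℂ f z₀ := by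
  obtain ⟨hm₀, he₀⟩ := hf z₀ hz₀
  have hs1 : √(ρ * ‖f z₀‖ ^ 2 * absMoment μ X 2 (f z₀) z₀) < 1 := by
    rw [Real.sqrt_lt' one_pos, one_pow]
    exact fixedPoint_absMoment_lt_one hX hb hM hρ hm₀ hz₀ he₀
  have hne : ∀ z : ℂ, 0 < z.im →
      1 - (ρ : ℂ) * f z * f z₀ * mixedMoment μ X 2 (f z) z (f z₀) z₀ ≠ 0 := by
    intro z hz h
    have hL := norm_mul_mixedMoment_le_sqrt hX hb hM hρ (hf z hz).1 hz hm₀ hz₀ (hf z hz).2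
    rw [← sub_eq_zero.1 h, norm_one] at hL
    linarith
  have him : ∀ᶠ z : ℂ in 𝓝[≠] z₀, 0 < z.im :=
    ((Complex.continuous_im.tendsto z₀).mono_left nhdsWithin_le_nhds).eventually
      (lt_mem_nhds hz₀)
  have hlim : Tendsto f (𝓝[≠] z₀) (𝓝 (f z₀)) :=
    (tendsto_fixedPoint hX hb hM hpos hρ hf hz₀).mono_left nhdsWithin_le_nhds
  have hmix : ∀ k, Tendsto (fun z => (ρ : ℂ) * f z * f z₀ * mixedMoment μ X k (f z) z (f z₀) z₀)
      (𝓝[≠] z₀) (𝓝 ((ρ : ℂ) * f z₀ * f z₀ * mixedMoment μ X k (f z₀) z₀ (f z₀) z₀)) :=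
    fun k => ((hlim.const_mul _).mul_const _).mul
      (tendsto_mixedMoment hX hb k nhdsWithin_le_nhds hz₀ hm₀.le
        (him.mono fun z hz => (hf z hz).1.le) hlim)
  refine (hasDerivAt_iff_tendsto_slope.2 (((hmix 1).neg.div ((hmix 2).const_sub 1)
    (hne z₀ hz₀)).congr' ?_)).differentiableAt
  filter_upwards [him, self_mem_nhdsWithin] with z hz hzne
  have hsub : z - z₀ ≠ 0 := sub_ne_zero.2 hzne
  rw [slope_def_field, Pi.div_apply, div_eq_div_iff (hne z hz) hsub]
  exact (fixedPoint_sub hX hb hM hpos hρ (hf z hz).1 hz hm₀ hz₀ (hf z hz).2 he₀).symm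

end SelfConsistent

/-- **Existence, uniqueness and holomorphy of the deterministic equivalent.** For a
compactly supported nonnegative random variable `X` (not a.s. zero) and `ρ > 0`, for every
`z` in the upper half-plane the self-consistent equation
`m = 1/(1 + ρ 𝔼[X/(Xm − z)])` has a unique solution with `Im m < 0`, and these solutions
assemble into a holomorphic function on the upper half-plane. -/
theorem deterministic_equivalent_exists_unique_holomorphic
    {Ω : Type*} [MeasureSpace Ω] [IsProbabilityMeasure (volume : Measure Ω)]
    (X : Ω → ℝ) (hX : Measurable X) (M : ℝ) (hM : 0 < M)
    (hbdd : ∀ᵐ ω, X ω ∈ Set.Icc 0 M) (hpos : 0 < volume {ω | 0 < X ω})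
    (ρ : ℝ) (hρ : 0 < ρ) :
    (∀ z : ℂ, 0 < z.im → ∃! m : ℂ, m.im < 0 ∧
      m = 1 / (1 + (ρ:ℂ) * ∫ ω, (X ω : ℂ) / ((X ω : ℂ) * m - z))) ∧
    ∃ mfun : ℂ → ℂ, DifferentiableOn ℂ mfun {z : ℂ | 0 < z.im} ∧
      ∀ z : ℂ, 0 < z.im → (mfun z).im < 0 ∧
        mfun z = 1 / (1 + (ρ:ℂ) * ∫ ω, (X ω : ℂ) / ((X ω : ℂ) * mfun z - z)) := by
  have hfix : ∀ z : ℂ, 0 < z.im →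
      ∃ m : ℂ, m.im < 0 ∧ m = SelfConsistent.selfMap volume X ρ z m :=
    fun z hz => SelfConsistent.exists_fixedPoint hX hbdd hM hpos hρ hz
  refine ⟨fun z hz => ?_, ?_⟩
  · obtain ⟨m, hm, he⟩ := hfix z hz
    exact ⟨m, ⟨hm, he⟩, fun m' h' =>
      SelfConsistent.fixedPoint_unique hX hbdd hM hpos hρ h'.1 hm hz h'.2 he⟩
  · choose! f hf using hfix
    exact ⟨f, fun z hz => (SelfConsistent.differentiableAt_fixedPoint hX hbdd hM hpos hρ hf
      hz).differentiableWithinAt, hf⟩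
end

section
/- Let α > 0 and β ∈ ℝ with 2α + 2β > 1, and let a ∈ (1, ∞). For each integer d ≥ 1 let v(d) be a positive integer with v(d) > d and v(d)/d → a as d → ∞, and let κ_d ∈ (0, ∞) be the unique solution of ∫_0^{v(d)/d} κ/(κ + u^{2α}) du = 1. Define F₀(d) = ∑_{j=1}^{v(d)} j^{−2(α+β)}/(1 + j^{−2α}·d^{2α}·κ_d). Then: (i) if β > 1/2, F₀(d) / [ (d^{−2α}/κ_d)·∑_{j=1}^{v(d)} j^{−2β} ] → 1 as d → ∞; and (ii) if β < 1/2, F₀(d) / [ d^{1 − 2(α+β)}·∫_0^{v(d)/d} u^{−2β}/(κ_d + u^{2α}) du ] → 1 as d → ∞. -/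
open Filter MeasureTheory Topology

lemma continuousOn_gap_integrand {p k : ℝ} (hp : 0 < p) (hk : 0 < k) (s : Set ℝ)
    (hs : ∀ u ∈ s, 0 ≤ u) : ContinuousOn (fun u : ℝ => k / (k + u ^ p)) s := by
  refine ContinuousOn.div continuousOn_const ?_ ?_
  · exact (continuous_const.add (Real.continuous_rpow_const hp.le)).continuousOn
  · intro u hu
    have := Real.rpow_nonneg (hs u hu) p
    positivity

lemma intervalIntegrable_gap_integrand {p k x y : ℝ} (hp : 0 < p) (hk : 0 < k) (hx : 0 ≤ x)
    (hxy : x ≤ y) : IntervalIntegrable (fun u : ℝ => k / (k + u ^ p)) volume x y := by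
  refine (continuousOn_gap_integrand hp hk _ ?_).intervalIntegrable
  intro u hu
  rw [Set.uIcc_of_le hxy] at hu
  exact hx.trans hu.1

/-- A solution of the spectral-gap equation is bounded away from zero. -/
lemma gap_lower_bound {p k w : ℝ} (hp : 0 < p) (hk : 0 < k) (hw : 1 < w)
    (h : ∫ u in (0:ℝ)..w, k / (k + u ^ p) = 1) :
    1 / 2 * (1 / 2 : ℝ) ^ p ≤ (w - 1 / 2) * k := by
  have hc : (0:ℝ) < (1 / 2 : ℝ) ^ p := by positivity
  have i1 := intervalIntegrable_gap_integrand (x := 0) (y := 1 / 2) hp hk le_rfl (by norm_num)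
  have i2 := intervalIntegrable_gap_integrand (x := 1 / 2) (y := w) hp hk (by norm_num)
    (by linarith)
  have b1 : ∫ u in (0:ℝ)..(1 / 2), k / (k + u ^ p) ≤ ∫ _ in (0:ℝ)..(1 / 2), (1:ℝ) := by
    refine intervalIntegral.integral_mono_on (by norm_num) i1 intervalIntegrable_const ?_
    intro u hu
    have := Real.rpow_nonneg hu.1 p
    rw [div_le_one (by positivity)]
    linarith
  have b2 : ∫ u in (1 / 2 : ℝ)..w, k / (k + u ^ p)
      ≤ ∫ _ in (1 / 2 : ℝ)..w, k / (1 / 2 : ℝ) ^ p := by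
    refine intervalIntegral.integral_mono_on (by linarith) i2 intervalIntegrable_const ?_
    intro u hu
    have := Real.rpow_le_rpow (by norm_num) hu.1 hp.le
    gcongr
    linarith
  rw [← intervalIntegral.integral_add_adjacent_intervals i1 i2] at h
  simp only [intervalIntegral.integral_const, smul_eq_mul] at b1 b2
  have h3 : 1 / 2 ≤ (w - 1 / 2) * k / (1 / 2 : ℝ) ^ p := by
    rw [mul_div_assoc]; linarith
  rwa [le_div_iff₀ hc] at h3

/-- A solution of the spectral-gap equation is bounded above. -/
lemma gap_upper_bound {p k w : ℝ} (hp : 0 < p) (hk : 0 < k) (hw : 1 < w)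
    (h : ∫ u in (0:ℝ)..w, k / (k + u ^ p) = 1) : (w - 1) * k ≤ w ^ p := by
  have i1 := intervalIntegrable_gap_integrand (x := 0) (y := w) hp hk le_rfl (by linarith)
  have hw0 : 0 ≤ w ^ p := Real.rpow_nonneg (by linarith) p
  have b : ∫ _ in (0:ℝ)..w, k / (k + w ^ p) ≤ ∫ u in (0:ℝ)..w, k / (k + u ^ p) := by
    refine intervalIntegral.integral_mono_on (by linarith) intervalIntegrable_const i1 ?_
    intro u hu
    have h1 := Real.rpow_le_rpow hu.1 hu.2 hp.le
    have h2 := Real.rpow_nonneg hu.1 p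
    gcongr
  rw [h, intervalIntegral.integral_const, smul_eq_mul, sub_zero, ← mul_div_assoc,
    div_le_one (by positivity)] at b
  linarith

/-- A right-endpoint Riemann sum is the integral of a step function. -/
lemma integral_ceil_step (g : ℝ → ℝ) {d : ℝ} (hd : 0 < d) (n : ℕ) :
    IntervalIntegrable (fun u => g ((⌈u * d⌉₊ : ℝ) / d)) volume 0 (n / d) ∧
    ∫ u in (0:ℝ)..(n / d), g ((⌈u * d⌉₊ : ℝ) / d)
      = (∑ j ∈ Finset.Icc 1 n, g ((j : ℝ) / d)) / d := by
  induction n with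
  | zero => simp
  | succ n ih =>
    have hle : (n : ℝ) / d ≤ (n + 1 : ℕ) / d := by gcongr; simp
    have key : Set.EqOn (fun _ => g (((n + 1 : ℕ) : ℝ) / d))
        (fun u : ℝ => g ((⌈u * d⌉₊ : ℝ) / d)) (Set.uIoc ((n : ℝ) / d) ((n + 1 : ℕ) / d)) := by
      intro u hu
      rw [Set.uIoc_of_le hle] at hu
      have h1 := (div_lt_iff₀ hd).1 hu.1
      have h2 := (le_div_iff₀ hd).1 hu.2
      have : ⌈u * d⌉₊ = n + 1 := by
        rw [Nat.ceil_eq_iff (by omega)]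
        exact ⟨by simpa using h1, h2⟩
      simp only [this]
    have i2 : IntervalIntegrable (fun u => g ((⌈u * d⌉₊ : ℝ) / d)) volume
        ((n : ℝ) / d) ((n + 1 : ℕ) / d) :=
      (intervalIntegrable_const (c := g (((n + 1 : ℕ) : ℝ) / d))).congr key
    refine ⟨ih.1.trans i2, ?_⟩
    rw [← intervalIntegral.integral_add_adjacent_intervals ih.1 i2, ih.2,
      Finset.sum_Icc_succ_top (by omega), add_div]
    congr 1
    rw [← intervalIntegral.integral_congr_ae (Eventually.of_forall key), intervalIntegral.integral_const, smul_eq_mul]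
    push_cast
    field_simp
    ring

lemma abs_gap_density_sub_le {c k x y A B : ℝ} (hc : 0 < c) (hk : c ≤ k) (hA : 0 ≤ A)
    (hB : 0 ≤ B) :
    |x / (k + A) - y / (k + B)| ≤ |x - y| / c + |y| * (|A - B| / c ^ 2) := by
  have hk0 := hc.trans_le hk
  have e : x / (k + A) - y / (k + B) = (x - y) / (k + A) + y * ((B - A) / ((k + A) * (k + B))) := by
    field_simp
    ring
  rw [e]
  refine (abs_add_le _ _).trans ?_
  rw [abs_div, abs_mul, abs_div, abs_of_pos (show 0 < k + A by positivity),
    abs_of_pos (show 0 < (k + A) * (k + B) by positivity), abs_sub_comm B A]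
  gcongr
  · linarith
  · rw [sq]
    gcongr <;> linarith

lemma rpow_le_add_rpow {q u x M : ℝ} (hu : 0 < u) (hux : u ≤ x) (hxM : x ≤ M) :
    x ^ q ≤ u ^ q + M ^ q := by
  have hx := hu.trans_le hux
  have hM := hx.trans_le hxM
  have h1 := Real.rpow_nonneg hu.le q
  have h2 := Real.rpow_nonneg hM.le q
  rcases le_total 0 q with hq | hq
  · linarith [Real.rpow_le_rpow hx.le hxM hq]
  · linarith [Real.rpow_le_rpow_of_nonpos hu hux hq]

lemma intervalIntegrable_gap_density {p q k w : ℝ} (hp : 0 < p) (hq : -1 < q) (hk : 0 < k)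
    (hw : 0 ≤ w) :
    IntervalIntegrable (fun u : ℝ => u ^ q / (k + u ^ p)) volume 0 w := by
  simp_rw [div_eq_mul_inv]
  refine (intervalIntegral.intervalIntegrable_rpow' hq).mul_continuousOn ?_
  refine ContinuousOn.inv₀
    (continuous_const.add (Real.continuous_rpow_const hp.le)).continuousOn ?_
  intro u hu
  rw [Set.uIcc_of_le hw] at hu
  have := Real.rpow_nonneg hu.1 p
  positivity

lemma gap_density_integral_lower {p q k w : ℝ} (hp : 0 < p) (hq : -1 < q) (hk : 0 < k)
    (hw : 1 < w) :
    1 / (q + 1) / (k + 1) ≤ ∫ u in (0:ℝ)..w, u ^ q / (k + u ^ p) := by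
  have i0 := intervalIntegrable_gap_density (w := w) hp hq hk (by linarith)
  have i1 := intervalIntegrable_gap_density (w := 1) hp hq hk (by linarith)
  have e : ∫ u in (0:ℝ)..1, u ^ q / (k + 1) = 1 / (q + 1) / (k + 1) := by
    rw [intervalIntegral.integral_div, integral_rpow (Or.inl hq), Real.one_rpow,
      Real.zero_rpow (by linarith), sub_zero]
  rw [← e]
  calc _ ≤ ∫ u in (0:ℝ)..1, u ^ q / (k + u ^ p) := by
        refine intervalIntegral.integral_mono_on zero_le_one
          ((intervalIntegral.intervalIntegrable_rpow' hq).div_const _) i1 ?_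
        intro u hu
        have h1 := Real.rpow_nonneg hu.1 p
        have h2 := Real.rpow_nonneg hu.1 q
        have h3 := Real.rpow_le_one hu.1 hu.2 hp.le
        gcongr
    _ ≤ _ := by
        refine intervalIntegral.integral_mono_interval le_rfl zero_le_one hw.le ?_ i0
        filter_upwards [ae_restrict_mem measurableSet_Ioc] with u hu
        have h1 := Real.rpow_nonneg hu.1.le p
        have h2 := Real.rpow_nonneg hu.1.le q
        simp only [Pi.zero_apply]
        positivity

lemma tendsto_ceil_mul_div (u : ℝ) (hu : 0 ≤ u) :
    Tendsto (fun d : ℕ => (⌈u * d⌉₊ : ℝ) / d) atTop (𝓝 u) :=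
  (tendsto_nat_ceil_mul_div_atTop hu).comp tendsto_natCast_atTop_atTop

/-- Riemann sums of `u ^ q / (κ d + u ^ p)` with mesh `1 / d` converge to the integral, uniformly
in `κ d` bounded below. -/
lemma tendsto_riemann_sub_integral {p q a c : ℝ} (hp : 0 < p) (hq : -1 < q) (hc : 0 < c)
    (v : ℕ → ℕ) (κ : ℕ → ℝ) (hv : ∀ᶠ d : ℕ in atTop, (v d : ℝ) / d ≤ a)
    (hκ : ∀ᶠ d in atTop, c ≤ κ d) :
    Tendsto (fun d : ℕ =>
      (∑ j ∈ Finset.Icc 1 (v d), ((j : ℝ) / d) ^ q / (κ d + ((j : ℝ) / d) ^ p)) / d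
        - ∫ u in (0:ℝ)..((v d : ℝ) / d), u ^ q / (κ d + u ^ p)) atTop (𝓝 0) := by
  set H : ℕ → ℝ → ℝ := fun d u =>
    ((⌈u * d⌉₊ : ℝ) / d) ^ q / (κ d + ((⌈u * d⌉₊ : ℝ) / d) ^ p) - u ^ q / (κ d + u ^ p)
  have hpos : ∀ᶠ d : ℕ in atTop, 1 ≤ d := eventually_ge_atTop 1
  have e : (fun d : ℕ => ∫ u, (Set.Ioc (0:ℝ) ((v d : ℝ) / d)).indicator (H d) u) =ᶠ[atTop]
      (fun d : ℕ =>
      (∑ j ∈ Finset.Icc 1 (v d), ((j : ℝ) / d) ^ q / (κ d + ((j : ℝ) / d) ^ p)) / d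
        - ∫ u in (0:ℝ)..((v d : ℝ) / d), u ^ q / (κ d + u ^ p)) := by
    filter_upwards [hpos, hκ] with d hd hkd
    have hd0 : (0:ℝ) < d := by exact_mod_cast hd
    have hw : (0:ℝ) ≤ (v d : ℝ) / d := by positivity
    obtain ⟨r1, r2⟩ := integral_ceil_step (fun x => x ^ q / (κ d + x ^ p)) hd0 (v d)
    rw [← r2, ← intervalIntegral.integral_sub r1
      (intervalIntegrable_gap_density hp hq (hc.trans_le hkd) hw),
      integral_indicator measurableSet_Ioc, intervalIntegral.integral_of_le hw]
  refine Tendsto.congr' e ?_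
  rw [show 𝓝 (0:ℝ) = 𝓝 (∫ _ : ℝ, (0:ℝ)) by simp]
  refine tendsto_integral_filter_of_dominated_convergence
    ((Set.Ioc (0:ℝ) a).indicator (fun u => (2 * u ^ q + a ^ q) / c)) ?_ ?_ ?_ ?_
  · refine Eventually.of_forall fun d => ?_
    refine Measurable.aestronglyMeasurable ?_
    refine Measurable.indicator ?_ measurableSet_Ioc
    have hm : Measurable (fun u : ℝ => (⌈u * d⌉₊ : ℝ) / d) := by fun_prop
    fun_prop
  · filter_upwards [hpos, hκ, hv] with d hd hkd hvd
    refine Eventually.of_forall fun u => ?_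
    have hd0 : (0:ℝ) < d := by exact_mod_cast hd
    by_cases hu : u ∈ Set.Ioc (0:ℝ) ((v d : ℝ) / d)
    · rw [Set.indicator_of_mem hu, Set.indicator_of_mem (Set.Ioc_subset_Ioc_right hvd hu)]
      have hk0 := hc.trans_le hkd
      have hu0 : 0 < u := hu.1
      have hux : u ≤ (⌈u * d⌉₊ : ℝ) / d := (le_div_iff₀ hd0).2 (Nat.le_ceil _)
      have hxv : (⌈u * d⌉₊ : ℝ) / d ≤ a := by
        refine le_trans ?_ hvd
        gcongr
        exact Nat.ceil_le.2 ((le_div_iff₀ hd0).1 hu.2)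
      have hx0 := hu0.trans_le hux
      have hxq := rpow_le_add_rpow (q := q) hu0 hux hxv
      have bd : ∀ y : ℝ, 0 < y → |y ^ q / (κ d + y ^ p)| ≤ y ^ q / c := by
        intro y hy
        rw [abs_of_nonneg (by positivity)]
        have := Real.rpow_pos_of_pos hy p
        gcongr
        linarith
      rw [Real.norm_eq_abs]
      calc _ ≤ _ := abs_sub _ _
        _ ≤ _ := add_le_add (bd _ hx0) (bd _ hu0)
        _ ≤ _ := by
          rw [← add_div]
          exact div_le_div_of_nonneg_right (by linarith) hc.le
    · rw [Set.indicator_of_notMem hu, norm_zero]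
      refine Set.indicator_nonneg (fun u hu => ?_) _
      have h1 := Real.rpow_nonneg hu.1.le q
      have h2 := Real.rpow_nonneg (hu.1.le.trans hu.2) q
      positivity
  · rw [integrable_indicator_iff measurableSet_Ioc]
    by_cases ha : 0 ≤ a
    · rw [← intervalIntegrable_iff_integrableOn_Ioc_of_le ha]
      exact (((intervalIntegral.intervalIntegrable_rpow' hq).const_mul 2).add
        intervalIntegrable_const).div_const _
    · rw [Set.Ioc_eq_empty (by linarith)]
      exact integrableOn_empty
  · refine Eventually.of_forall fun u => ?_
    by_cases hu : 0 < u
    · have hx := tendsto_ceil_mul_div u hu.le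
      have t1 : Tendsto (fun d : ℕ => |((⌈u * d⌉₊ : ℝ) / d) ^ q - u ^ q| / c
          + |u ^ q| * (|((⌈u * d⌉₊ : ℝ) / d) ^ p - u ^ p| / c ^ 2)) atTop (𝓝 0) := by
        have s1 := ((hx.rpow_const (p := q) (Or.inl hu.ne')).sub_const (u ^ q)).abs.div_const c
        have s2 := (((hx.rpow_const (p := p) (Or.inl hu.ne')).sub_const (u ^ p)).abs.div_const
          (c ^ 2)).const_mul |u ^ q|
        simpa using s1.add s2
      refine squeeze_zero_norm' ?_ t1
      filter_upwards [hκ] with d hkd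
      refine (norm_indicator_le_norm_self _ _).trans ?_
      rw [Real.norm_eq_abs]
      exact abs_gap_density_sub_le hc hkd (by positivity) (by positivity)
    · have : ∀ d : ℕ, (Set.Ioc (0:ℝ) ((v d : ℝ) / d)).indicator (H d) u = 0 := fun d =>
        Set.indicator_of_notMem (fun h => hu h.1) _
      simp [this]

/-- A summable sequence damped by factors `1 / (1 + x)` with `x → 0` loses nothing in the limit. -/
lemma tendsto_damped_sum_ratio {p s c : ℝ} (hp : 0 < p) (hs : 1 < s) (hc : 0 < c)
    (v : ℕ → ℕ) (κ : ℕ → ℝ) (hv : ∀ᶠ d in atTop, 1 ≤ v d) (hκ : ∀ᶠ d in atTop, c ≤ κ d) :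
    Tendsto (fun d : ℕ =>
      (∑ j ∈ Finset.Icc 1 (v d), (j : ℝ) ^ (-s) / (1 + ((j : ℝ) / d) ^ p / κ d))
        / ∑ j ∈ Finset.Icc 1 (v d), (j : ℝ) ^ (-s)) atTop (𝓝 1) := by
  have hsum : Summable (fun j : ℕ => (j : ℝ) ^ (-s)) :=
    Real.summable_nat_rpow.2 (by linarith)
  set f : ℕ → ℕ → ℝ := fun d j =>
    (j : ℝ) ^ (-s) * ((((j : ℝ) / d) ^ p / κ d) / (1 + ((j : ℝ) / d) ^ p / κ d)) with hf
  have hf0 : ∀ᶠ d in atTop, ∀ j, 0 ≤ f d j ∧ f d j ≤ (j : ℝ) ^ (-s) := by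
    filter_upwards [hκ] with d hkd j
    have hk0 := hc.trans_le hkd
    refine ⟨by positivity, mul_le_of_le_one_right (by positivity) ?_⟩
    rw [div_le_one (by positivity)]
    linarith
  have hlim : Tendsto (fun d => ∑' j, f d j) atTop (𝓝 0) := by
    rw [show 𝓝 (0:ℝ) = 𝓝 (∑' _ : ℕ, (0:ℝ)) by simp]
    refine tendsto_tsum_of_dominated_convergence hsum ?_ ?_
    · intro j
      have t : Tendsto (fun d : ℕ => (j : ℝ) ^ (-s) * (((j : ℝ) / d) ^ p / c)) atTop (𝓝 0) := by
        have h0 := ((tendsto_const_div_atTop_nhds_zero_nat (j : ℝ)).rpow_const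
          (p := p) (Or.inr hp.le)).div_const c
        rw [Real.zero_rpow hp.ne', zero_div] at h0
        simpa using h0.const_mul ((j : ℝ) ^ (-s))
      refine squeeze_zero' (hf0.mono fun d hd => (hd j).1) ?_ t
      filter_upwards [hκ] with d hkd
      have hk0 := hc.trans_le hkd
      have hy : 0 ≤ ((j : ℝ) / d) ^ p / κ d := by positivity
      simp only [hf]
      refine mul_le_mul_of_nonneg_left ?_ (by positivity)
      refine (div_le_self hy (le_add_of_nonneg_right hy)).trans ?_
      gcongr
    · filter_upwards [hf0] with d hd j
      rw [Real.norm_of_nonneg (hd j).1]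
      exact (hd j).2
  rw [tendsto_iff_norm_sub_tendsto_zero]
  refine squeeze_zero' (Eventually.of_forall fun _ => norm_nonneg _) ?_ hlim
  filter_upwards [hv, hκ, hf0] with d hvd hkd hfd
  have hk0 := hc.trans_le hkd
  have hS : 1 ≤ ∑ j ∈ Finset.Icc 1 (v d), (j : ℝ) ^ (-s) := by
    have := Finset.single_le_sum (f := fun j : ℕ => (j : ℝ) ^ (-s))
      (fun j _ => by positivity) (Finset.mem_Icc.2 ⟨le_rfl, hvd⟩)
    simpa using this
  have hT : ∑ j ∈ Finset.Icc 1 (v d), (j : ℝ) ^ (-s) / (1 + ((j : ℝ) / d) ^ p / κ d)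
      = ∑ j ∈ Finset.Icc 1 (v d), (j : ℝ) ^ (-s) - ∑ j ∈ Finset.Icc 1 (v d), f d j := by
    rw [← Finset.sum_sub_distrib]
    refine Finset.sum_congr rfl fun j _ => ?_
    have hy : 0 ≤ ((j : ℝ) / d) ^ p / κ d := by positivity
    simp only [hf]
    generalize ((j : ℝ) / d) ^ p / κ d = y at hy
    field_simp
    ring
  have hR0 : 0 ≤ ∑ j ∈ Finset.Icc 1 (v d), f d j := Finset.sum_nonneg fun j _ => (hfd j).1
  have hR : ∑ j ∈ Finset.Icc 1 (v d), f d j ≤ ∑' j, f d j :=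
    (Summable.of_nonneg_of_le (fun j => (hfd j).1) (fun j => (hfd j).2) hsum).sum_le_tsum _
      fun j _ => (hfd j).1
  rw [hT, sub_div, div_self (by linarith), Real.norm_eq_abs, sub_sub_cancel_left, abs_neg,
    abs_of_nonneg (by positivity)]
  exact (div_le_self hR0 hS).trans hR


/-- **Asymptotics of the limiting loss value `F₀`.** With `v(d)/d → a > 1` and `κ_d` the
spectral-gap parameter, `F₀(d) = ∑_{j=1}^{v(d)} j^{−2(α+β)}/(1 + j^{−2α} d^{2α} κ_d)`
satisfies `F₀(d) ∼ (d^{−2α}/κ_d) ∑_{j=1}^{v(d)} j^{−2β}` when `β > 1/2`, and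
`F₀(d) ∼ d^{1−2(α+β)} ∫₀^{v(d)/d} u^{−2β}/(κ_d + u^{2α}) du` when `β < 1/2`. -/
theorem F0_asymptotics (α β a : ℝ) (hα : 0 < α) (hαβ : 1 < 2*α + 2*β) (ha : 1 < a)
    (v : ℕ → ℕ) (hv : ∀ d : ℕ, 1 ≤ d → d < v d)
    (hlim : Filter.Tendsto (fun d : ℕ => (v d : ℝ) / d) Filter.atTop (nhds a))
    (κ : ℕ → ℝ) (hκpos : ∀ d : ℕ, 1 ≤ d → 0 < κ d)
    (hκ : ∀ d : ℕ, 1 ≤ d →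
      ∫ u in (0:ℝ)..((v d : ℝ)/d), κ d / (κ d + u ^ (2*α)) = 1) :
    let F₀ : ℕ → ℝ := fun d => ∑ j ∈ Finset.Icc 1 (v d),
      (j:ℝ) ^ (-(2*(α+β))) / (1 + (j:ℝ) ^ (-(2*α)) * (d:ℝ) ^ (2*α) * κ d)
    ((1/2 < β) → Filter.Tendsto (fun d : ℕ =>
        F₀ d / (((d:ℝ) ^ (-(2*α)) / κ d) * ∑ j ∈ Finset.Icc 1 (v d), (j:ℝ) ^ (-(2*β))))
        Filter.atTop (nhds 1)) ∧
    ((β < 1/2) → Filter.Tendsto (fun d : ℕ =>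
        F₀ d / ((d:ℝ) ^ (1 - 2*(α+β)) *
          ∫ u in (0:ℝ)..((v d : ℝ)/d), u ^ (-(2*β)) / (κ d + u ^ (2*α))))
        Filter.atTop (nhds 1)) := by
  intro F₀
  have hw : ∀ d : ℕ, 1 ≤ d → 1 < (v d : ℝ) / d := by
    intro d hd
    rw [one_lt_div (by exact_mod_cast hd)]
    exact_mod_cast hv d hd
  have hpos : ∀ᶠ d : ℕ in Filter.atTop, 1 ≤ d := Filter.eventually_ge_atTop 1
  have hwa : ∀ᶠ d : ℕ in Filter.atTop, (v d : ℝ) / d ≤ a + 1 :=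
    hlim.eventually_le_const (by linarith)
  have hwa' : ∀ᶠ d : ℕ in Filter.atTop, (a + 1) / 2 ≤ (v d : ℝ) / d :=
    hlim.eventually_const_le (by linarith)
  have hp : 0 < 2 * α := by linarith
  obtain ⟨c, hc, hκc⟩ : ∃ c : ℝ, 0 < c ∧ ∀ᶠ d in Filter.atTop, c ≤ κ d := by
    refine ⟨1 / 2 * (1 / 2 : ℝ) ^ (2 * α) / (a + 1), by positivity, ?_⟩
    filter_upwards [hpos, hwa] with d hd hda
    have h := gap_lower_bound hp (hκpos d hd) (hw d hd) (hκ d hd)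
    rw [div_le_iff₀ (by linarith)]
    nlinarith [hκpos d hd]
  have term : ∀ d : ℕ, 1 ≤ d → ∀ j : ℕ, 1 ≤ j →
      (j:ℝ) ^ (-(2*(α+β))) / (1 + (j:ℝ) ^ (-(2*α)) * (d:ℝ) ^ (2*α) * κ d)
        = (j:ℝ) ^ (-(2*β)) / ((j:ℝ) ^ (2*α) + (d:ℝ) ^ (2*α) * κ d) := by
    intro d hd j hj
    have hk := hκpos d hd
    have hj0 : (0:ℝ) < j := by exact_mod_cast hj
    rw [show -(2*(α+β)) = -(2*β) - 2*α by ring, Real.rpow_sub hj0, Real.rpow_neg hj0.le (2*α)]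
    field_simp
  constructor
  · intro hβ
    refine (tendsto_damped_sum_ratio hp (show 1 < 2 * β by linarith) hc v κ
      (hpos.mono fun d hd => by have := hv d hd; omega) hκc).congr' ?_
    filter_upwards [hpos] with d hd
    have hk := hκpos d hd
    have hd0 : (0:ℝ) < d := by exact_mod_cast hd
    have hF : F₀ d = ((d:ℝ) ^ (-(2*α)) / κ d) * ∑ j ∈ Finset.Icc 1 (v d),
        (j : ℝ) ^ (-(2*β)) / (1 + ((j : ℝ) / d) ^ (2*α) / κ d) := by
      simp only [F₀]
      rw [Finset.mul_sum]
      refine Finset.sum_congr rfl fun j hj => ?_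
      have hj1 := (Finset.mem_Icc.1 hj).1
      have hj0 : (0:ℝ) < j := by exact_mod_cast hj1
      rw [term d hd j hj1, Real.div_rpow hj0.le hd0.le, Real.rpow_neg hd0.le]
      field_simp
      ring
    rw [hF, mul_div_mul_left _ _ (by positivity)]
  · intro hβ
    have hq : -1 < -(2 * β) := by linarith
    obtain ⟨m, hm, hI⟩ : ∃ m : ℝ, 0 < m ∧ ∀ᶠ d : ℕ in Filter.atTop,
        m ≤ ∫ u in (0:ℝ)..((v d : ℝ)/d), u ^ (-(2*β)) / (κ d + u ^ (2*α)) := by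
      have ha' : 0 < (a - 1) / 2 := by linarith
      have hq' : 0 < -(2 * β) + 1 := by linarith
      refine ⟨1 / (-(2 * β) + 1) / ((a + 1) ^ (2 * α) / ((a - 1) / 2) + 1), by positivity, ?_⟩
      filter_upwards [hpos, hwa, hwa'] with d hd h1 h2
      have hk := hκpos d hd
      refine le_trans ?_ (gap_density_integral_lower hp hq hk (hw d hd))
      have h3 := gap_upper_bound hp hk (hw d hd) (hκ d hd)
      have h4 : ((v d : ℝ) / d) ^ (2 * α) ≤ (a + 1) ^ (2 * α) :=
        Real.rpow_le_rpow (by positivity) h1 hp.le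
      gcongr
      rw [le_div_iff₀ ha']
      nlinarith
    have hdiff := tendsto_riemann_sub_integral hp hq hc v κ hwa hκc
    rw [tendsto_iff_norm_sub_tendsto_zero]
    have hdiff' := hdiff.norm.div_const m
    rw [norm_zero, zero_div] at hdiff'
    refine squeeze_zero' (Filter.Eventually.of_forall fun _ => norm_nonneg _) ?_ hdiff'
    filter_upwards [hpos, hI] with d hd hId
    have hk := hκpos d hd
    have hd0 : (0:ℝ) < d := by exact_mod_cast hd
    have hF : F₀ d = (d:ℝ) ^ (1 - 2*(α+β)) * ((∑ j ∈ Finset.Icc 1 (v d),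
        ((j : ℝ) / d) ^ (-(2*β)) / (κ d + ((j : ℝ) / d) ^ (2*α))) / d) := by
      simp only [F₀]
      rw [Finset.sum_div, Finset.mul_sum]
      refine Finset.sum_congr rfl fun j hj => ?_
      have hj1 := (Finset.mem_Icc.1 hj).1
      have hj0 : (0:ℝ) < j := by exact_mod_cast hj1
      rw [term d hd j hj1, Real.div_rpow hj0.le hd0.le, Real.div_rpow hj0.le hd0.le,
        show 1 - 2*(α+β) = 1 + -(2*β) - 2*α by ring, Real.rpow_sub hd0, Real.rpow_add hd0,
        Real.rpow_one]
      field_simp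
      ring
    rw [hF, mul_div_mul_left _ _ (by positivity)]
    generalize (∑ j ∈ Finset.Icc 1 (v d),
        ((j : ℝ) / d) ^ (-(2*β)) / (κ d + ((j : ℝ) / d) ^ (2*α))) / (d : ℝ) = R
    generalize (∫ u in (0:ℝ)..((v d : ℝ)/d), u ^ (-(2*β)) / (κ d + u ^ (2*α))) = I at hId
    have hI0 := hm.trans_le hId
    rw [← div_self hI0.ne', ← sub_div, norm_div, Real.norm_of_nonneg hI0.le]
    gcongr
end
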